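/- A graph is a unit Helly circular-arc (UHCA) graph if and only if it is both a proper Helly circular-arc (PHCA) graph and a unit circular-arc (UCA) graph. Moreover, every unit circular-arc model of a UHCA graph that is not an interval graph is itself a UHCA model. -/

import Mathlib

open Set

noncomputable section

instance : Fact ((0:ℝ) < 1) := ⟨one_pos⟩

/-- A point on the circle (of circumference 1). -/
abbrev Circ : Type := AddCircle (1 : ℝ)

/-- An arc of the circle, described by its beginning point `s` and its ending point `t`
(the arc is traversed clockwise, i.e. in the positive circular direction, from `s` to `t`). -/
structure Arc where
  s : Circ
  t : Circ

/-- The set of points of the open arc: the points strictly between `s` and `t`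
in the circular order. -/
def Arc.pts (A : Arc) : Set Circ := {x | sbtw A.s x A.t}

/-- The length of an arc: the representative in `(0, 1]` of `t - s`. -/
def Arc.length (A : Arc) : ℝ := ((AddCircle.equivIoc (1:ℝ) 0) (A.t - A.s) : ℝ)

/-- A circular-arc (CA) model: a finite family of arcs of the circle such that all
endpoints of the arcs are pairwise distinct (in particular each arc has two distinct
endpoints, hence no arc covers the whole circle). -/
structure CAModel (V : Type) [Fintype V] where
  arc : V → Arc
  endpoints_distinct : Function.Injective
    (fun p : V × Bool => if p.2 then (arc p.1).s else (arc p.1).t)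

namespace CAModel

variable {V : Type} [Fintype V]

/-- The arcs of `u` and `v` intersect. -/
def Inter (M : CAModel V) (u v : V) : Prop := ((M.arc u).pts ∩ (M.arc v).pts).Nonempty

/-- The intersection graph of the model: two distinct arcs are adjacent iff they have
nonempty intersection. -/
def interGraph (M : CAModel V) : SimpleGraph V :=
  SimpleGraph.fromRel fun u v => M.Inter u v

/-- `M` is a model of the graph `G`: the arcs are in correspondence with the vertices of `G`
and two vertices are adjacent iff their arcs are distinct and intersect. -/
def IsModelOf (M : CAModel V) (G : SimpleGraph V) : Prop :=
  ∀ u v, G.Adj u v ↔ u ≠ v ∧ M.Inter u v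

/-- Helly model: every subfamily of pairwise intersecting arcs has a common point. -/
def Helly (M : CAModel V) : Prop :=
  ∀ S : Set V, (∀ u ∈ S, ∀ v ∈ S, M.Inter u v) → ∃ p : Circ, ∀ v ∈ S, p ∈ (M.arc v).pts

/-- Normal model: no two arcs together cover the whole circle. -/
def Normal (M : CAModel V) : Prop :=
  ∀ u v : V, u ≠ v → (M.arc u).pts ∪ (M.arc v).pts ≠ Set.univ

/-- No three arcs together cover the whole circle. -/
def NoThreeCover (M : CAModel V) : Prop :=
  ∀ u v w : V, u ≠ v → u ≠ w → v ≠ w →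
    (M.arc u).pts ∪ (M.arc v).pts ∪ (M.arc w).pts ≠ Set.univ

/-- Proper model: no arc is properly contained in another arc. -/
def Proper (M : CAModel V) : Prop :=
  ∀ u v : V, u ≠ v → ¬ (M.arc u).pts ⊂ (M.arc v).pts

/-- Unit model: all arcs have the same length. -/
def IsUnit (M : CAModel V) : Prop :=
  ∀ u v : V, (M.arc u).length = (M.arc v).length

/-- Interval model: some point of the circle is covered by no arc. -/
def IsIntervalModel (M : CAModel V) : Prop :=
  ∃ p : Circ, ∀ v : V, p ∉ (M.arc v).pts

/-- A universal arc: it intersects every other arc of the model. -/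
def UniversalArc (M : CAModel V) (v : V) : Prop :=
  ∀ w, w ≠ v → M.Inter v w

end CAModel

section GraphClasses

variable {V : Type} [Fintype V]

def IsCAGraph (G : SimpleGraph V) : Prop := ∃ M : CAModel V, M.IsModelOf G
def IsHCAGraph (G : SimpleGraph V) : Prop := ∃ M : CAModel V, M.Helly ∧ M.IsModelOf G
def IsNCAGraph (G : SimpleGraph V) : Prop := ∃ M : CAModel V, M.Normal ∧ M.IsModelOf G
def IsNHCAGraph (G : SimpleGraph V) : Prop :=
  ∃ M : CAModel V, M.Normal ∧ M.Helly ∧ M.IsModelOf G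
def IsPCAGraph (G : SimpleGraph V) : Prop := ∃ M : CAModel V, M.Proper ∧ M.IsModelOf G
def IsNPCAGraph (G : SimpleGraph V) : Prop :=
  ∃ M : CAModel V, M.Normal ∧ M.Proper ∧ M.IsModelOf G
def IsPHCAGraph (G : SimpleGraph V) : Prop :=
  ∃ M : CAModel V, M.Proper ∧ M.Helly ∧ M.IsModelOf G
def IsUCAGraph (G : SimpleGraph V) : Prop := ∃ M : CAModel V, M.IsUnit ∧ M.IsModelOf G
def IsUHCAGraph (G : SimpleGraph V) : Prop :=
  ∃ M : CAModel V, M.IsUnit ∧ M.Helly ∧ M.IsModelOf G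
def IsIntervalGraph (G : SimpleGraph V) : Prop :=
  ∃ M : CAModel V, M.IsIntervalModel ∧ M.IsModelOf G

end GraphClasses
/-! ### Some small graphs -/

/-- The claw `K_{1,3}`: vertex `0` is adjacent to `1`, `2`, `3`, which are pairwise
non-adjacent. -/
def claw : SimpleGraph (Fin 4) := SimpleGraph.fromRel fun u _ => u = 0

/-- The `n`-wheel `W_n`: a chordless cycle on `n` vertices plus one extra vertex adjacent
to all of them (intended for `n ≥ 4`). -/
def wheel (n : ℕ) : SimpleGraph (Fin n ⊕ Unit) :=
  SimpleGraph.fromRel fun u v =>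
    (∃ x, u = Sum.inr x) ∨
    (∃ i j : Fin n, u = Sum.inl i ∧ v = Sum.inl j ∧ ((i : ℕ) + 1) % n = (j : ℕ))

/-- The 3-sun `S_3`: vertices `0,1,2` (the `v_i`'s) are pairwise adjacent, vertices
`3,4,5` (the `w_i`'s) are pairwise non-adjacent, and `w_i` is adjacent exactly to
`v_i` and `v_{i+1 (mod 3)}`. -/
def sun3 : SimpleGraph (Fin 6) :=
  SimpleGraph.fromRel fun u v =>
    ((u : ℕ) < 3 ∧ (v : ℕ) < 3) ∨
    (3 ≤ (u : ℕ) ∧ ((v : ℕ) = (u : ℕ) - 3 ∨ (v : ℕ) = ((u : ℕ) - 2) % 3))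

/-- The tent: the complement of the 3-sun. -/
def tent : SimpleGraph (Fin 6) := sun3ᶜ

/-- The `n`-rising sun `R_n` (intended for `n ≥ 4`): vertices `inl 0, …, inl (n-1)`
are `v_1, …, v_n` where `v_2, …, v_{n-1}` form a path in this order and `v_1`, `v_n`
are adjacent to all the `v`'s; `inr 0 = w_1` is adjacent exactly to `v_1, v_2`;
`inr 1 = w_{n-1}` is adjacent exactly to `v_{n-1}, v_n`; and `inr 2 = w_n` is adjacent
exactly to `v_n, v_1`. -/
def risingSun (n : ℕ) : SimpleGraph (Fin n ⊕ Fin 3) :=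
  SimpleGraph.fromRel fun u v =>
    match u, v with
    | Sum.inl a, Sum.inl b => (a : ℕ) = 0 ∨ (a : ℕ) = n - 1 ∨ (b : ℕ) = (a : ℕ) + 1
    | Sum.inr w, Sum.inl a =>
        ((w : ℕ) = 0 ∧ ((a : ℕ) = 0 ∨ (a : ℕ) = 1)) ∨
        ((w : ℕ) = 1 ∧ ((a : ℕ) = n - 2 ∨ (a : ℕ) = n - 1)) ∨
        ((w : ℕ) = 2 ∧ ((a : ℕ) = n - 1 ∨ (a : ℕ) = 0))
    | _, _ => False

/-- The umbrella: a path `0,1,2,3,4`, a vertex `5` adjacent to all of `0,…,4`, and a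
vertex `6` adjacent only to `2`. -/
def umbrella : SimpleGraph (Fin 7) :=
  SimpleGraph.fromRel fun u v =>
    ((u : ℕ) < 5 ∧ (v : ℕ) = (u : ℕ) + 1 ∧ (v : ℕ) < 5) ∨
    ((u : ℕ) = 5 ∧ (v : ℕ) < 5) ∨
    ((u : ℕ) = 6 ∧ (v : ℕ) = 2)
theorem mem_pts_iff (a b x : ℝ) (h1 : a < b) (h2 : b < a + 1) :
    (x : Circ) ∈ (Arc.mk (a : Circ) (b : Circ)).pts ↔ ∃ n : ℤ, a < x + n ∧ x + n < b := by
  have hb : toIcoMod (one_pos : (0:ℝ) < 1) a b = b :=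
    (toIcoMod_eq_self _).2 ⟨h1.le, h2⟩
  have key : (x : Circ) ∈ (Arc.mk (a : Circ) (b : Circ)).pts ↔
      toIocMod (one_pos : (0:ℝ) < 1) a x < toIcoMod (one_pos : (0:ℝ) < 1) a b := by
    show sbtw (a : Circ) (x : Circ) (b : Circ) ↔ _
    rw [sbtw_cyclic, sbtw_cyclic, sbtw_iff_not_btw]
    rw [← not_le]
    exact not_congr QuotientAddGroup.btw_coe_iff
  rw [key, hb]
  have hm := toIocMod_mem_Ioc (one_pos : (0:ℝ) < 1) a x
  have hz := toIocMod_add_toIocDiv_zsmul (one_pos : (0:ℝ) < 1) a x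
  set y := toIocMod (one_pos : (0:ℝ) < 1) a x
  set k := toIocDiv (one_pos : (0:ℝ) < 1) a x
  simp only [zsmul_eq_mul, mul_one] at hz
  constructor
  · intro h
    refine ⟨-k, ?_, ?_⟩
    · push_cast; linarith [hm.1]
    · push_cast; linarith
  · rintro ⟨n, hn1, hn2⟩
    have : y = x + n := by
      have h3 : ((n + k : ℤ) : ℝ) < 1 := by push_cast; linarith [hm.1, hm.2]
      have h4 : (-1 : ℝ) < ((n + k : ℤ) : ℝ) := by push_cast; linarith [hm.1, hm.2]
      have h5 : n + k < 1 := by exact_mod_cast h3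
      have h6 : -1 < n + k := by exact_mod_cast h4
      have h7 : k = -n := by omega
      rw [h7] at hz; push_cast at hz; linarith
    linarith

theorem exists_lift (a : ℝ) (z : Circ) : ∃ p : ℝ, a ≤ p ∧ p < a + 1 ∧ (p : Circ) = z := by
  have : z ∈ ((↑) : ℝ → Circ) '' Ico a (a + 1) := by
    rw [AddCircle.coe_image_Ico_eq]; trivial
  obtain ⟨p, hp, rfl⟩ := this
  exact ⟨p, hp.1, hp.2, rfl⟩

theorem coe_add_int (x : ℝ) (n : ℤ) : ((x + n : ℝ) : Circ) = (x : Circ) := by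
  have h : ((n : ℝ) : Circ) = 0 := by
    rw [AddCircle.coe_eq_zero_iff]; exact ⟨n, by simp⟩
  rw [AddCircle.coe_add, h, add_zero]

namespace CAModel

variable {V : Type} [Fintype V]

theorem s_ne_t (M : CAModel V) (u v : V) : (M.arc u).s ≠ (M.arc v).t := by
  intro h
  have := @M.endpoints_distinct (u, true) (v, false) (by simpa using h)
  simp at this

theorem s_inj (M : CAModel V) {u v : V} (h : (M.arc u).s = (M.arc v).s) : u = v := by
  have := @M.endpoints_distinct (u, true) (v, true) (by simpa using h)
  simpa using this

theorem t_inj (M : CAModel V) {u v : V} (h : (M.arc u).t = (M.arc v).t) : u = v := by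
  have := @M.endpoints_distinct (u, false) (v, false) (by simpa using h)
  simpa using this

/-- Every arc lifts to a real interval, with start in a prescribed fundamental domain. -/
theorem exists_lift_arc (M : CAModel V) (a : ℝ) (v : V) : ∃ p q : ℝ, a ≤ p ∧ p < a + 1 ∧
    a ≤ q ∧ q < a + 1 ∧ p ≠ q ∧ (M.arc v) = ⟨(p : Circ), (q : Circ)⟩ := by
  obtain ⟨p, hp1, hp2, hp⟩ := exists_lift a (M.arc v).s
  obtain ⟨q, hq1, hq2, hq⟩ := exists_lift a (M.arc v).t
  refine ⟨p, q, hp1, hp2, hq1, hq2, ?_, ?_⟩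
  · rintro rfl
    exact M.s_ne_t v v (hp.symm.trans hq)
  · rw [hp, hq]

theorem inter_symm (M : CAModel V) {u v : V} (h : M.Inter u v) : M.Inter v u := by
  unfold Inter at *; rwa [Set.inter_comm]

theorem pts_nonempty (M : CAModel V) (v : V) : (M.arc v).pts.Nonempty := by
  obtain ⟨p, q, h1, h2, h3, h4, h5, h⟩ := M.exists_lift_arc 0 v
  rw [h]
  rcases lt_or_gt_of_ne h5 with h6 | h6
  · exact ⟨(((p + q) / 2 : ℝ) : Circ), (mem_pts_iff p q _ h6 (by linarith)).2
      ⟨0, by push_cast; constructor <;> linarith⟩⟩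
  · have : (q : Circ) = ((q + 1 : ℝ) : Circ) := by
      have := coe_add_int q 1
      push_cast at this; exact this.symm
    rw [this]
    exact ⟨(((p + (q + 1)) / 2 : ℝ) : Circ), (mem_pts_iff p (q+1) _ (by linarith) (by linarith)).2
      ⟨0, by push_cast; constructor <;> linarith⟩⟩

theorem inter_self (M : CAModel V) (v : V) : M.Inter v v := by
  unfold Inter; rw [Set.inter_self]; exact M.pts_nonempty v

/-- `M` is described by real numbers `σ` (starting points) and a common length `ℓ`. -/
def UnitData (M : CAModel V) (ℓ : ℝ) (σ : V → ℝ) : Prop :=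
  0 < ℓ ∧ ℓ < 1 ∧ ∀ v, M.arc v = ⟨(σ v : Circ), ((σ v + ℓ : ℝ) : Circ)⟩

theorem exists_unitData (M : CAModel V) (hU : M.IsUnit) (v0 : V) :
    ∃ ℓ σ, M.UnitData ℓ σ := by
  choose σ _ _ hσ using fun v => exists_lift 0 (M.arc v).s
  have hd : ∀ v, (((M.arc v0).length : ℝ) : Circ) = (M.arc v).t - (M.arc v).s := by
    intro v
    rw [hU v0 v]
    exact AddCircle.coe_equivIoc
  have hm : (M.arc v0).length ∈ Ioc (0:ℝ) (0 + 1) :=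
    ((AddCircle.equivIoc (1:ℝ) 0) ((M.arc v0).t - (M.arc v0).s)).2
  refine ⟨(M.arc v0).length, σ, hm.1, ?_, ?_⟩
  · refine lt_of_le_of_ne (by linarith [hm.2]) ?_
    intro h
    have h1 := hd v0
    rw [h] at h1
    have h2 : ((1 : ℝ) : Circ) = 0 := AddCircle.coe_period 1
    rw [h2] at h1
    exact M.s_ne_t v0 v0 (sub_eq_zero.1 h1.symm).symm
  · intro v
    rw [AddCircle.coe_add, hσ, hd v]
    simp

theorem UnitData.mem_pts {M : CAModel V} {ℓ : ℝ} {σ : V → ℝ} (h : M.UnitData ℓ σ) (v : V) (x : ℝ) :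
    (x : Circ) ∈ (M.arc v).pts ↔ ∃ n : ℤ, σ v < x + n ∧ x + n < σ v + ℓ := by
  rw [h.2.2 v]
  exact mem_pts_iff _ _ _ (by linarith [h.1]) (by linarith [h.2.1])

theorem UnitData.inter_iff {M : CAModel V} {ℓ : ℝ} {σ : V → ℝ} (h : M.UnitData ℓ σ) (u v : V) :
    M.Inter u v ↔ ∃ n : ℤ, |σ u - σ v + n| < ℓ := by
  constructor
  · rintro ⟨z, hz1, hz2⟩
    obtain ⟨x, -, -, rfl⟩ := exists_lift 0 z
    obtain ⟨n, hn1, hn2⟩ := (h.mem_pts u x).1 hz1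
    obtain ⟨m, hm1, hm2⟩ := (h.mem_pts v x).1 hz2
    refine ⟨m - n, ?_⟩
    rw [abs_lt]; push_cast
    constructor <;> linarith
  · rintro ⟨n, hn⟩
    rw [abs_lt] at hn
    refine ⟨(((σ u + n + σ v + ℓ) / 2 : ℝ) : Circ), (h.mem_pts _ _).2 ⟨-n, ?_⟩,
      (h.mem_pts _ _).2 ⟨0, ?_⟩⟩
    · push_cast; constructor <;> linarith
    · push_cast; constructor <;> linarith

theorem proper_of_unit (M : CAModel V) (hU : M.IsUnit) : M.Proper := by
  intro u v huv hss
  obtain ⟨ℓ, σ, h⟩ := M.exists_unitData hU u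
  obtain ⟨p, hp1, hp2, hp⟩ := exists_lift (σ v) (M.arc u).s
  have hp1' : σ v < p := by
    refine lt_of_le_of_ne hp1 ?_
    intro h'
    apply huv
    apply M.s_inj
    rw [← hp, ← h', h.2.2 v]
  have hpu : (p : Circ) = (σ u : Circ) := by rw [hp, h.2.2 u]
  have harc : M.arc u = ⟨(p : Circ), ((p + ℓ : ℝ) : Circ)⟩ := by
    rw [AddCircle.coe_add, hpu, ← AddCircle.coe_add]; exact h.2.2 u
  have hℓ := h.1
  have hℓ1 := h.2.1
  obtain ⟨y, hy1, hy2⟩ : ∃ y, max p (σ v + ℓ) < y ∧ y < min (p + ℓ) (σ v + 1) :=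
    exists_between (by
      rw [max_lt_iff, lt_min_iff, lt_min_iff]
      refine ⟨⟨?_, ?_⟩, ?_, ?_⟩ <;> linarith)
  rw [max_lt_iff] at hy1
  rw [lt_min_iff] at hy2
  have hyu : (y : Circ) ∈ (M.arc u).pts := by
    rw [harc, mem_pts_iff _ _ _ (by linarith) (by linarith)]
    exact ⟨0, by push_cast; constructor <;> linarith⟩
  obtain ⟨n, hn1, hn2⟩ := (h.mem_pts v y).1 (hss.1 hyu)
  have h1 : (n : ℝ) < 0 := by linarith
  have h2 : (-1 : ℝ) < n := by linarith
  have h1' : n < 0 := by exact_mod_cast h1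
  have h2' : -1 < n := by exact_mod_cast h2
  omega

/-- In a proper Helly model, the closed neighbourhood of any vertex is a unit interval graph. -/
theorem nbhd_rep (M : CAModel V) (hP : M.Proper) (hH : M.Helly) (u : V) :
    ∃ x : V → ℝ, ∀ v w, M.Inter u v → M.Inter u w → (M.Inter v w ↔ |x v - x w| < 1) := by
  obtain ⟨a, -, -, ha⟩ := exists_lift 0 (M.arc u).s
  choose p q hp1 hp2 hq1 hq2 hpq harc using M.exists_lift_arc a
  have hs : ∀ v, (p v : Circ) = (M.arc v).s := fun v => by rw [harc v]
  have ht : ∀ v, (q v : Circ) = (M.arc v).t := fun v => by rw [harc v]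
  -- membership
  have memA : ∀ v, p v < q v → ∀ x, a ≤ x → x < a + 1 →
      ((x : Circ) ∈ (M.arc v).pts ↔ p v < x ∧ x < q v) := by
    intro v hv x hx1 hx2
    rw [harc v, mem_pts_iff _ _ _ hv (by linarith [hp1 v, hq2 v])]
    constructor
    · rintro ⟨n, h1, h2⟩
      have h3 : (n : ℝ) < 1 := by linarith [hq2 v]
      have h4 : (-1 : ℝ) < n := by linarith [hp1 v]
      have h3' : n < 1 := by exact_mod_cast h3
      have h4' : -1 < n := by exact_mod_cast h4
      have : n = 0 := by omega
      subst this
      push_cast at h1 h2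
      constructor <;> linarith
    · rintro ⟨h1, h2⟩
      exact ⟨0, by push_cast; constructor <;> linarith⟩
  have memB : ∀ v, q v < p v → ∀ x, a ≤ x → x < a + 1 →
      ((x : Circ) ∈ (M.arc v).pts ↔ p v < x ∨ x < q v) := by
    intro v hv x hx1 hx2
    have h0 : (q v : Circ) = ((q v + 1 : ℝ) : Circ) := by
      have := coe_add_int (q v) 1
      push_cast at this; exact this.symm
    rw [harc v, h0, mem_pts_iff _ _ _ (by linarith [hp2 v, hq1 v]) (by linarith)]
    constructor
    · rintro ⟨n, h1, h2⟩
      have h3 : (n : ℝ) < 2 := by linarith [hp2 v]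
      have h4 : (-1 : ℝ) < n := by linarith [hp1 v]
      have h3' : n < 2 := by exact_mod_cast h3
      have h4' : -1 < n := by exact_mod_cast h4
      have : n = 0 ∨ n = 1 := by omega
      rcases this with rfl | rfl
      · push_cast at h1; left; linarith
      · push_cast at h2; right; linarith
    · rintro (h1 | h1)
      · exact ⟨0, by push_cast; constructor <;> linarith [hq1 v]⟩
      · exact ⟨1, by push_cast; constructor <;> linarith [hp2 v]⟩
  have hpu : p u = a := by
    have : (p u : Circ) = (a : Circ) := by rw [hs, ha]
    rwa [AddCircle.coe_eq_coe_iff_of_mem_Ico (a := a) ⟨hp1 u, hp2 u⟩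
      ⟨le_refl a, by linarith⟩] at this
  have hqu : a < q u := lt_of_le_of_ne (hq1 u) (by rw [← hpu]; exact hpq u)
  have hqu1 := hq2 u
  set l := q u with hl
  have memu : ∀ x, a ≤ x → x < a + 1 → ((x : Circ) ∈ (M.arc u).pts ↔ a < x ∧ x < l) := by
    intro x h1 h2
    rw [memA u (by rw [hpu]; exact hqu) x h1 h2, hpu]
  have neA : ∀ v, v ≠ u → a < p v ∧ a < q v ∧ p v ≠ l ∧ q v ≠ l := by
    intro v hv
    refine ⟨lt_of_le_of_ne (hp1 v) ?_, lt_of_le_of_ne (hq1 v) ?_, ?_, ?_⟩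
    · intro h; exact hv (M.s_inj (by rw [← hs, ← h, ha]))
    · intro h; exact M.s_ne_t u v (by rw [← ht, ← h, ha])
    · intro h; exact M.s_ne_t v u (by rw [← ht, ← hs, h])
    · intro h; exact hv (M.t_inj (by rw [← ht, ← ht, h]))
  -- classification
  have cls : ∀ v, M.Inter u v → v ≠ u → (q v < l ∧ l < p v) ∨ (p v < l ∧ l < q v) ∨
      (q v < p v ∧ p v < l) := by
    intro v hi hv
    obtain ⟨h1, h2, h3, h4⟩ := neA v hv
    obtain ⟨z, hz1, hz2⟩ := hi
    obtain ⟨x, hx1, hx2, rfl⟩ := exists_lift a z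
    rw [memu x hx1 hx2] at hz1
    rcases lt_or_gt_of_ne (hpq v) with h | h
    · rw [memA v h x hx1 hx2] at hz2
      right; left
      refine ⟨by linarith, ?_⟩
      by_contra hc
      refine hP v u hv ⟨?_, ?_⟩
      · intro z hz
        obtain ⟨y, hy1, hy2, rfl⟩ := exists_lift a z
        rw [memA v h y hy1 hy2] at hz
        rw [memu y hy1 hy2]
        constructor <;> linarith
      · intro hsub
        have := hsub ((memu (p v) (hp1 v) (hp2 v)).2 ⟨h1, by linarith⟩)
        rw [memA v h _ (hp1 v) (hp2 v)] at this
        exact lt_irrefl _ this.1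
    · rcases lt_or_gt_of_ne h3 with h5 | h5
      · exact Or.inr (Or.inr ⟨h, h5⟩)
      · left
        refine ⟨?_, h5⟩
        by_contra hc
        have hc' : l < q v := lt_of_le_of_ne (not_lt.1 hc) (Ne.symm h4)
        refine hP u v (Ne.symm hv) ⟨?_, ?_⟩
        · intro z hz
          obtain ⟨y, hy1, hy2, rfl⟩ := exists_lift a z
          rw [memu y hy1 hy2] at hz
          rw [memB v h y hy1 hy2]
          right; linarith
        · intro hsub
          have := hsub ((memB v h l (by linarith) hqu1).2 (Or.inr hc'))
          rw [memu l (by linarith) hqu1] at this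
          exact lt_irrefl _ this.2
  -- intersection of a left arc and a right arc
  have LR : ∀ v w, M.Inter u v → M.Inter u w → (q v < l ∧ l < p v) → (p w < l ∧ l < q w) →
      (M.Inter v w ↔ p w < q v) := by
    intro v w hv hw hvL hwR
    constructor
    · intro hi
      obtain ⟨z, hz⟩ := hH {u, v, w} (by
        intro i hi' j hj'
        simp only [Set.mem_insert_iff, Set.mem_singleton_iff] at hi' hj'
        rcases hi' with rfl | rfl | rfl <;> rcases hj' with rfl | rfl | rfl <;>
          first
          | exact M.inter_self _
          | assumption
          | (apply M.inter_symm; assumption))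
      obtain ⟨x, hx1, hx2, rfl⟩ := exists_lift a z
      have hzu := hz u (by simp)
      have hzv := hz v (by simp)
      have hzw := hz w (by simp)
      rw [memu x hx1 hx2] at hzu
      rw [memB v (by linarith) x hx1 hx2] at hzv
      rw [memA w (by linarith) x hx1 hx2] at hzw
      rcases hzv with h | h <;> linarith
    · intro h
      refine ⟨(((p w + q v) / 2 : ℝ) : Circ), ?_, ?_⟩
      · rw [memB v (by linarith) _ (by linarith [hp1 w, hq1 v]) (by linarith [hp2 w, hq2 v])]
        right; linarith
      · rw [memA w (by linarith) _ (by linarith [hp1 w, hq1 v]) (by linarith [hp2 w, hq2 v])]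
        constructor <;> linarith
  classical
  let x : V → ℝ := fun v => if v = u then a else
    if q v < l ∧ l < p v then q v - 1 else if p v < l ∧ l < q v then p v else a
  have amem : ∀ v, q v < p v → a < q v → (a : Circ) ∈ (M.arc v).pts := fun v h h' =>
    (memB v h a le_rfl (by linarith)).2 (Or.inr h')
  have lmem : ∀ v, p v < l ∧ l < q v → (l : Circ) ∈ (M.arc v).pts := fun v h =>
    (memA v (by linarith) l (by linarith) hqu1).2 h
  have lmem' : ∀ v, q v < p v ∧ p v < l → (l : Circ) ∈ (M.arc v).pts := fun v h =>
    (memB v h.1 l (by linarith) hqu1).2 (Or.inl h.2)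
  have mkI : ∀ v w (z : Circ), z ∈ (M.arc v).pts → z ∈ (M.arc w).pts → M.Inter v w :=
    fun v w z h1 h2 => ⟨z, h1, h2⟩
  -- the value of x
  have val : ∀ v, M.Inter u v → (x v = a ∧ ∀ w, M.Inter u w → M.Inter v w) ∨
      ((q v < l ∧ l < p v) ∧ x v = q v - 1 ∧ a < q v) ∨
      ((p v < l ∧ l < q v) ∧ x v = p v ∧ a < p v) := by
    intro v hv
    by_cases hvu : v = u
    · left; subst hvu; exact ⟨by simp [x], fun w h => h⟩
    · have hne := neA v hvu
      rcases cls v hv hvu with h | h | h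
      · right; left; exact ⟨h, by simp only [x, if_neg hvu, if_pos h], hne.2.1⟩
      · right; right
        refine ⟨h, ?_, hne.1⟩
        simp only [x, if_neg hvu]
        rw [if_neg (by intro h'; linarith), if_pos h]
      · left
        refine ⟨?_, ?_⟩
        · simp only [x, if_neg hvu]
          rw [if_neg (by intro h'; linarith), if_neg (by intro h'; linarith)]
        · intro w hw
          by_cases hwu : w = u
          · subst hwu; exact M.inter_symm hv
          · rcases cls w hw hwu with h' | h' | h'
            · exact mkI v w a (amem v h.1 hne.2.1) (amem w (by linarith) (neA w hwu).2.1)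
            · exact mkI v w l (lmem' v h) (lmem w h')
            · exact mkI v w l (lmem' v h) (lmem' w h')
  refine ⟨x, ?_⟩
  intro v w hv hw
  have b1 := hp1 v
  have b2 := hp2 v
  have b3 := hq1 v
  have b4 := hq2 v
  have c1 := hp1 w
  have c2 := hp2 w
  have c3 := hq1 w
  have c4 := hq2 w
  rcases val v hv with ⟨h1, h2⟩ | ⟨h1, h2, h3⟩ | ⟨h1, h2, h3⟩ <;>
  rcases val w hw with ⟨k1, k2⟩ | ⟨k1, k2, k3⟩ | ⟨k1, k2, k3⟩
  · exact iff_of_true (h2 w hw) (by rw [h1, k1]; simp)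
  · exact iff_of_true (h2 w hw) (by rw [h1, k2, abs_lt]; constructor <;> linarith)
  · exact iff_of_true (h2 w hw) (by rw [h1, k2, abs_lt]; constructor <;> linarith)
  · exact iff_of_true (M.inter_symm (k2 v hv)) (by rw [h2, k1, abs_lt]; constructor <;> linarith)
  · exact iff_of_true (mkI v w a (amem v (by linarith) h3) (amem w (by linarith) k3))
      (by rw [h2, k2, abs_lt]; constructor <;> linarith)
  · rw [LR v w hv hw h1 k1, h2, k2, abs_lt]
    constructor
    · intro h; constructor <;> linarith
    · intro h; linarith
  · exact iff_of_true (M.inter_symm (k2 v hv)) (by rw [h2, k1, abs_lt]; constructor <;> linarith)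
  · have : M.Inter v w ↔ M.Inter w v := ⟨M.inter_symm, M.inter_symm⟩
    rw [this, LR w v hw hv k1 h1, h2, k2, abs_lt]
    constructor
    · intro h; constructor <;> linarith
    · intro h; linarith
  · exact iff_of_true (mkI v w l (lmem v h1) (lmem w k1))
      (by rw [h2, k2, abs_lt]; constructor <;> linarith)

/-- A proper Helly model contains no 4-wheel. -/
theorem no_wheel4 (M : CAModel V) (hP : M.Proper) (hH : M.Helly) (B A X C Z : V)
    (hA : M.Inter B A) (hX : M.Inter B X) (hC : M.Inter B C) (hZ : M.Inter B Z)
    (hAX : ¬ M.Inter A X) (hCZ : ¬ M.Inter C Z) (hAC : M.Inter A C) (hAZ : M.Inter A Z)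
    (hXC : M.Inter X C) (hXZ : M.Inter X Z) : False := by
  obtain ⟨x, hx⟩ := M.nbhd_rep hP hH B
  rw [hx _ _ hA hX, not_lt, le_abs] at hAX
  rw [hx _ _ hC hZ, not_lt, le_abs] at hCZ
  rw [hx _ _ hA hC, abs_lt] at hAC
  rw [hx _ _ hA hZ, abs_lt] at hAZ
  rw [hx _ _ hX hC, abs_lt] at hXC
  rw [hx _ _ hX hZ, abs_lt] at hXZ
  rcases hAX with h | h <;> rcases hCZ with h' | h' <;> linarith [hAC.1, hAC.2, hAZ.1, hAZ.2,
    hXC.1, hXC.2, hXZ.1, hXZ.2]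

end CAModel

/-- If `a, b, c` are the starts of three covering arcs, anything missing the first arc hits the
other two. -/
theorem cover_aux (ℓ a b c x : ℝ) (h1 : a < b) (h2 : b < c) (h3 : b - a < ℓ) (h4 : c - b < ℓ)
    (h5 : a + 1 - c < ℓ) (hx : ∀ n : ℤ, ¬ |x - a + n| < ℓ) :
    (∃ n : ℤ, |x - b + n| < ℓ) ∧ (∃ n : ℤ, |x - c + n| < ℓ) := by
  set n : ℤ := -⌊x - a⌋ with hn
  have e1 : (n : ℝ) = -(⌊x - a⌋ : ℝ) := by rw [hn]; push_cast; rfl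
  have f1 := Int.floor_le (x - a)
  have f2 := Int.lt_floor_add_one (x - a)
  have g1 := hx n
  have g2 := hx (n - 1)
  push_cast at g2
  rw [abs_lt] at g1 g2
  have k1 : ℓ ≤ x - a + n := by
    by_contra h; exact g1 ⟨by linarith, by linarith⟩
  have k2 : x - a + (n - 1) ≤ -ℓ := by
    by_contra h; exact g2 ⟨by linarith, by linarith⟩
  refine ⟨⟨n, ?_⟩, ⟨n, ?_⟩⟩ <;> rw [abs_lt] <;> constructor <;> linarith

/-- With length more than one third, no three arcs are pairwise disjoint. -/
theorem indep_aux (ℓ x y z : ℝ) (h : 1 < 3 * ℓ) (hxy : ∀ n : ℤ, ¬ |x - y + n| < ℓ)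
    (hxz : ∀ n : ℤ, ¬ |x - z + n| < ℓ) (hyz : ∀ n : ℤ, ¬ |y - z + n| < ℓ) : False := by
  set n : ℤ := -⌊x - y⌋ with hn
  have e1 : (n : ℝ) = -(⌊x - y⌋ : ℝ) := by rw [hn]; push_cast; rfl
  have f1 := Int.floor_le (x - y)
  have f2 := Int.lt_floor_add_one (x - y)
  set m : ℤ := -⌊x - z⌋ with hm
  have e2 : (m : ℝ) = -(⌊x - z⌋ : ℝ) := by rw [hm]; push_cast; rfl
  have f3 := Int.floor_le (x - z)
  have f4 := Int.lt_floor_add_one (x - z)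
  have g1 := hxy n
  have g2 := hxy (n - 1)
  have g3 := hxz m
  have g4 := hxz (m - 1)
  have g5 := hyz (m - n)
  push_cast at g2 g4 g5
  rw [abs_lt] at g1 g2 g3 g4
  have k1 : ℓ ≤ x - y + n := by
    by_contra h; exact g1 ⟨by linarith, by linarith⟩
  have k2 : x - y + (n - 1) ≤ -ℓ := by
    by_contra h; exact g2 ⟨by linarith, by linarith⟩
  have k3 : ℓ ≤ x - z + m := by
    by_contra h; exact g3 ⟨by linarith, by linarith⟩
  have k4 : x - z + (m - 1) ≤ -ℓ := by
    by_contra h; exact g4 ⟨by linarith, by linarith⟩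
  rw [not_lt, le_abs] at g5
  rcases g5 with g | g <;> linarith

namespace CAModel

variable {V : Type} [Fintype V]

/-- A unit model with short arcs that is not Helly contains three arcs covering the circle. -/
theorem UnitData.cover_of_not_helly {M : CAModel V} {ℓ : ℝ} {σ : V → ℝ} (h : M.UnitData ℓ σ)
    (hl : ℓ ≤ 1 / 2) (hH : ¬ M.Helly) :
    ∃ (A B C : V) (i j : ℤ), σ A + i < σ B ∧ σ B < σ C + j ∧ σ B - (σ A + i) < ℓ ∧
      σ C + j - σ B < ℓ ∧ σ A + i + 1 - (σ C + j) < ℓ := by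
  unfold Helly at hH
  push Not at hH
  obtain ⟨S, hS, hno⟩ := hH
  obtain ⟨u, hu, -⟩ := hno 0
  have hex : ∀ v, ∃ n : ℤ, v ∈ S → |σ v - σ u + n| < ℓ := by
    intro v
    by_cases hv : v ∈ S
    · obtain ⟨n, hn⟩ := (h.inter_iff v u).1 (hS v hv u hu)
      exact ⟨n, fun _ => hn⟩
    · exact ⟨0, fun h => absurd h hv⟩
  choose k hk using hex
  obtain ⟨A, hA, hmin⟩ := Set.exists_min_image S (fun v => σ v + k v) (Set.toFinite S) ⟨u, hu⟩
  obtain ⟨C, hC, hmax⟩ := Set.exists_max_image S (fun v => σ v + k v) (Set.toFinite S) ⟨u, hu⟩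
  have hkA := abs_lt.1 (hk A hA)
  have hkC := abs_lt.1 (hk C hC)
  have hlen : ℓ ≤ (σ C + k C) - (σ A + k A) := by
    by_contra hlt
    push Not at hlt
    obtain ⟨v, hv, hv'⟩ := hno ((((σ C + k C) + (σ A + k A) + ℓ) / 2 : ℝ) : Circ)
    apply hv'
    rw [h.mem_pts]
    have h1 := hmin v hv
    have h2 := hmax v hv
    beta_reduce at h1 h2
    refine ⟨-k v, ?_⟩
    push_cast
    constructor <;> linarith
  obtain ⟨n, hn⟩ := (h.inter_iff C A).1 (hS C hC A hA)
  rw [abs_lt] at hn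
  have h1 : ((n - k C + k A : ℤ) : ℝ) < 0 := by push_cast; linarith
  have h2 : (-2 : ℝ) < ((n - k C + k A : ℤ) : ℝ) := by push_cast; linarith
  have h1' : n - k C + k A < 0 := by exact_mod_cast h1
  have h2' : -2 < n - k C + k A := by exact_mod_cast h2
  have h3 : n = k C - k A - 1 := by omega
  have h4 : (n : ℝ) = k C - k A - 1 := by rw [h3]; push_cast; ring
  refine ⟨A, u, C, k A, k C, ?_, ?_, ?_, ?_, ?_⟩ <;> linarith

theorem core {V W : Type} [Fintype V] [Fintype W] (M1 : CAModel V) (hP : M1.Proper)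
    (hH : M1.Helly) (M2 : CAModel W) (hU : M2.IsUnit) (e : V ≃ W)
    (he : ∀ u v, u ≠ v → (M1.Inter u v ↔ M2.Inter (e u) (e v))) :
    M2.Helly ∨ ∃ x : V → ℝ, ∀ u v, (M1.Inter u v ↔ |x u - x v| < 1) := by
  have he' : ∀ u v, M2.Inter u v ↔ M1.Inter (e.symm u) (e.symm v) := by
    intro u v
    by_cases huv : u = v
    · subst huv; exact iff_of_true (M2.inter_self _) (M1.inter_self _)
    · rw [he _ _ (by simpa using huv)]; simp
  by_cases hall : ∀ u v, M2.Inter u v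
  · right
    refine ⟨fun _ => 0, fun u v => iff_of_true ?_ (by simp)⟩
    have := (he' (e u) (e v)).1 (hall _ _)
    simpa using this
  push Not at hall
  obtain ⟨u0, v0, h0⟩ := hall
  obtain ⟨ℓ, σ, h⟩ := M2.exists_unitData hU u0
  have hl : ℓ ≤ 1 / 2 := by
    by_contra hc
    apply h0
    rw [h.inter_iff]
    refine ⟨-round (σ u0 - σ v0), ?_⟩
    have := abs_sub_round (σ u0 - σ v0)
    push_cast
    rw [← sub_eq_add_neg]
    linarith
  by_cases hM2 : M2.Helly
  · exact Or.inl hM2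
  right
  have univ_case : ∀ A, (∀ X, M2.Inter A X) →
      ∃ x : V → ℝ, ∀ u v, (M1.Inter u v ↔ |x u - x v| < 1) := by
    intro A hA
    obtain ⟨x, hx⟩ := M1.nbhd_rep hP hH (e.symm A)
    have hall : ∀ v, M1.Inter (e.symm A) v := by
      intro v
      have := (he' A (e v)).1 (hA _)
      simpa using this
    exact ⟨x, fun u v => hx u v (hall u) (hall v)⟩
  obtain ⟨A, B, C, i, j, c1, c2, c3, c4, c5⟩ := h.cover_of_not_helly hl hM2
  by_cases hA : ∀ X, M2.Inter A X
  · exact univ_case A hA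
  by_cases hB : ∀ X, M2.Inter B X
  · exact univ_case B hB
  by_cases hC : ∀ X, M2.Inter C X
  · exact univ_case C hC
  exfalso
  push Not at hA hB hC
  obtain ⟨X, hX⟩ := hA
  obtain ⟨Y, hY⟩ := hB
  obtain ⟨Z, hZ⟩ := hC
  have shift : ∀ P Q (i : ℤ), (∃ n : ℤ, |σ P - (σ Q + i) + n| < ℓ) ↔ M2.Inter P Q := by
    intro P Q i
    rw [h.inter_iff]
    constructor
    · rintro ⟨n, hn⟩
      exact ⟨n - i, by push_cast; convert hn using 2; ring⟩
    · rintro ⟨n, hn⟩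
      exact ⟨n + i, by push_cast; convert hn using 2; ring⟩
  have shift0 : ∀ P Q, (∃ n : ℤ, |σ P - σ Q + n| < ℓ) ↔ M2.Inter P Q := fun P Q =>
    (h.inter_iff P Q).symm
  have shift1 : ∀ P Q (i : ℤ), (∃ n : ℤ, |σ P - (σ Q + i + 1) + n| < ℓ) ↔ M2.Inter P Q := by
    intro P Q i
    rw [← shift P Q (i + 1)]
    push_cast
    simp only [add_assoc]
  have sy : ∀ {P Q}, M2.Inter P Q → M2.Inter Q P := fun h => M2.inter_symm h
  obtain ⟨XB, XC⟩ := cover_aux ℓ _ _ _ (σ X) c1 c2 c3 c4 c5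
    (fun n hn => hX (sy ((shift X A i).1 ⟨n, hn⟩)))
  rw [shift0] at XB
  rw [shift] at XC
  obtain ⟨YC, YA⟩ := cover_aux ℓ _ _ (σ A + i + 1) (σ Y) c2 (by linarith) c4 c5 (by linarith)
    (fun n hn => hY (sy ((shift0 Y B).1 ⟨n, hn⟩)))
  rw [shift] at YC
  rw [shift1] at YA
  obtain ⟨ZA, ZB⟩ := cover_aux ℓ (σ C + j) (σ A + i + 1) (σ B + 1) (σ Z) (by linarith)
    (by linarith) c5 (by linarith) (by linarith)
    (fun n hn => hZ (sy ((shift Z C j).1 ⟨n, hn⟩)))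
  rw [shift1] at ZA
  have ZB' : M2.Inter Z B := by
    rw [← shift Z B 1]; push_cast; exact ZB
  have AB : M2.Inter A B := by
    rw [h.inter_iff]; exact ⟨i, by rw [abs_lt]; constructor <;> linarith⟩
  have CB : M2.Inter C B := by
    rw [h.inter_iff]; exact ⟨j, by rw [abs_lt]; constructor <;> linarith⟩
  have AC : M2.Inter A C := by
    rw [h.inter_iff]
    refine ⟨i + 1 - j, ?_⟩
    push_cast
    rw [abs_lt]; constructor <;> linarith
  have wheel : ∀ B A X C Z : W, M2.Inter B A → M2.Inter B X → M2.Inter B C → M2.Inter B Z →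
      ¬ M2.Inter A X → ¬ M2.Inter C Z → M2.Inter A C → M2.Inter A Z → M2.Inter X C →
      M2.Inter X Z → False := by
    intro B A X C Z
    simp only [he']
    exact M1.no_wheel4 hP hH _ _ _ _ _
  by_cases XZ : M2.Inter X Z
  · exact wheel B A X C Z (sy AB) (sy XB) (sy CB) (sy ZB') hX hZ AC (sy ZA) XC XZ
  by_cases XY : M2.Inter X Y
  · exact wheel C A X B Y (sy AC) (sy XC) CB (sy YC) hX hY AB (sy YA) XB XY
  by_cases YZ : M2.Inter Y Z
  · exact wheel A B Y C Z AB (sy YA) AC (sy ZA) hY hZ (sy CB) (sy ZB') YC YZ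
  exact indep_aux ℓ (σ X) (σ Y) (σ Z) (by linarith)
    (fun n hn => XY ((shift0 _ _).1 ⟨n, hn⟩)) (fun n hn => XZ ((shift0 _ _).1 ⟨n, hn⟩))
    (fun n hn => YZ ((shift0 _ _).1 ⟨n, hn⟩))

end CAModel

/-- Put a unit interval representation in general position and scale it down. -/
theorem perturb {V : Type} [Fintype V] (x : V → ℝ) : ∃ (c : ℝ) (y : V → ℝ), 0 < c ∧ c < 1 / 4 ∧
    (∀ v, |y v| < 1 / 4) ∧ Function.Injective y ∧ (∀ u v, |y u - y v| ≠ c) ∧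
    ∀ u v, |x u - x v| < 1 ↔ |y u - y v| < c := by
  obtain ⟨k⟩ : Nonempty (V ≃ Fin (Fintype.card V)) := ⟨Fintype.equivFin V⟩
  -- choose the threshold
  have hc : ∀ᶠ c : ℝ in nhdsWithin 1 (Set.Iio 1), 0 < c ∧ ∀ u v, |x u - x v| < 1 → |x u - x v| < c := by
    apply Filter.Eventually.and
    · exact nhdsWithin_le_nhds (lt_mem_nhds one_pos)
    · rw [Filter.eventually_all]; intro u
      rw [Filter.eventually_all]; intro v
      by_cases h : |x u - x v| < 1
      · filter_upwards [nhdsWithin_le_nhds (lt_mem_nhds h)] with c hc _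
        exact hc
      · exact Filter.Eventually.of_forall fun c h' => absurd h' h
  obtain ⟨c, ⟨hc0, hc1⟩, hc2⟩ := (hc.and self_mem_nhdsWithin).exists
  have hc2 : c < 1 := hc2
  have hcont : ∀ u v, Filter.Tendsto (fun ε : ℝ => |(x u + ε * (k u : ℕ)) - (x v + ε * (k v : ℕ))|)
      (nhdsWithin 0 (Set.Ioi 0)) (nhds |x u - x v|) := by
    intro u v
    have : Continuous (fun ε : ℝ => |(x u + ε * (k u : ℕ)) - (x v + ε * (k v : ℕ))|) := by fun_prop
    have h2 := this.tendsto 0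
    simp only [zero_mul, add_zero] at h2
    exact h2.mono_left nhdsWithin_le_nhds
  have hε : ∀ᶠ ε : ℝ in nhdsWithin 0 (Set.Ioi 0), ∀ u v,
      ((|x u - x v| < 1 → |(x u + ε * (k u : ℕ)) - (x v + ε * (k v : ℕ))| < c) ∧
      (¬ |x u - x v| < 1 → c < |(x u + ε * (k u : ℕ)) - (x v + ε * (k v : ℕ))|)) ∧
      (u ≠ v → x u + ε * (k u : ℕ) ≠ x v + ε * (k v : ℕ)) := by
    rw [Filter.eventually_all]; intro u
    rw [Filter.eventually_all]; intro v
    refine Filter.Eventually.and (Filter.Eventually.and ?_ ?_) ?_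
    · by_cases h : |x u - x v| < 1
      · filter_upwards [(hcont u v).eventually (gt_mem_nhds (hc1 u v h))] with ε h' _
        exact h'
      · exact Filter.Eventually.of_forall fun c h' => absurd h' h
    · by_cases h : |x u - x v| < 1
      · exact Filter.Eventually.of_forall fun c h' => absurd h h'
      · filter_upwards [(hcont u v).eventually (lt_mem_nhds (hc2.trans_le (not_lt.1 h)))] with ε h' _
        exact h'
    · by_cases huv : x u = x v
      · filter_upwards [self_mem_nhdsWithin] with ε hε hne heq
        have hε : 0 < ε := hε
        rw [huv] at heq
        have h1 : ε * ((k u : ℕ) : ℝ) = ε * ((k v : ℕ) : ℝ) := by linarith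
        have h2 := mul_left_cancel₀ hε.ne' h1
        have h3 : (k u : ℕ) = (k v : ℕ) := by exact_mod_cast h2
        exact hne (k.injective (Fin.ext h3))
      · have : 0 < |x u - x v| := abs_pos.2 (sub_ne_zero.2 huv)
        filter_upwards [(hcont u v).eventually (lt_mem_nhds this)] with ε h' _ heq
        rw [heq, sub_self, abs_zero] at h'
        exact lt_irrefl _ h'
  obtain ⟨ε, hε⟩ := hε.exists
  set y : V → ℝ := fun v => x v + ε * (k v : ℕ) with hy
  have hε' : ∀ u v, ((|x u - x v| < 1 → |y u - y v| < c) ∧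
      (¬ |x u - x v| < 1 → c < |y u - y v|)) ∧ (u ≠ v → y u ≠ y v) := hε
  -- scale
  have hr : ∀ᶠ r : ℝ in nhdsWithin 0 (Set.Ioi 0), r * c < 1 / 4 ∧ ∀ v, r * |y v| < 1 / 4 := by
    have ht : ∀ z : ℝ, ∀ᶠ r : ℝ in nhdsWithin 0 (Set.Ioi 0), r * z < 1 / 4 := by
      intro z
      have : Continuous (fun r : ℝ => r * z) := by fun_prop
      have h2 := this.tendsto 0
      simp only [zero_mul] at h2
      exact (h2.mono_left nhdsWithin_le_nhds).eventually (gt_mem_nhds (by norm_num))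
    refine (ht c).and ?_
    rw [Filter.eventually_all]
    exact fun v => ht _
  obtain ⟨r, ⟨hr1, hr2⟩, hr0⟩ := (hr.and self_mem_nhdsWithin).exists
  have hr0 : 0 < r := hr0
  have habs : ∀ u v, |r * y u - r * y v| = r * |y u - y v| := by
    intro u v; rw [← mul_sub, abs_mul, abs_of_pos hr0]
  refine ⟨r * c, fun v => r * y v, by positivity, hr1, ?_, ?_, ?_, ?_⟩
  · intro v; rw [abs_mul, abs_of_pos hr0]; exact hr2 v
  · intro u v huv
    by_contra hne
    exact (hε' u v).2 hne (mul_left_cancel₀ hr0.ne' huv)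
  · intro u v
    simp only [habs]
    intro heq
    have h1 := mul_left_cancel₀ hr0.ne' heq
    by_cases h : |x u - x v| < 1
    · exact (((hε' u v).1.1 h).ne) h1
    · exact (((hε' u v).1.2 h).ne') h1
  · intro u v
    simp only [habs]
    rw [mul_lt_mul_iff_right₀ hr0]
    by_cases h : |x u - x v| < 1
    · exact iff_of_true h ((hε' u v).1.1 h)
    · exact iff_of_false h (not_lt.2 ((hε' u v).1.2 h).le)

/-- A unit interval representation gives a unit Helly interval model. -/
theorem model_of_rep {V : Type} [Fintype V] (x : V → ℝ) : ∃ M : CAModel V, M.IsUnit ∧ M.Helly ∧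
    M.IsIntervalModel ∧ ∀ u v, M.Inter u v ↔ |x u - x v| < 1 := by
  obtain ⟨c, y, hc0, hc1, hy, hinj, hne, hiff⟩ := perturb x
  have hy' : ∀ v, -(1/4) < y v ∧ y v < 1/4 := fun v => abs_lt.1 (hy v)
  have cinj : ∀ a b : ℝ, -(1/2) ≤ a → a < 1/2 → -(1/2) ≤ b → b < 1/2 → (a : Circ) = (b : Circ) →
      a = b := by
    intro a b h1 h2 h3 h4 h
    exact (AddCircle.coe_eq_coe_iff_of_mem_Ico (p := (1:ℝ)) (a := -(1/2))
      ⟨h1, by linarith⟩ ⟨h3, by linarith⟩).1 h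
  let M : CAModel V :=
    { arc := fun v => ⟨(y v : Circ), ((y v + c : ℝ) : Circ)⟩
      endpoints_distinct := by
        rintro ⟨u, b⟩ ⟨v, b'⟩ h
        have hu := hy' u
        have hv := hy' v
        cases b <;> cases b' <;> simp only [if_true, Bool.false_eq_true, if_false] at h <;>
          have h := cinj _ _ (by linarith) (by linarith) (by linarith) (by linarith) h
        · rw [hinj (add_right_cancel h)]
        · exact absurd (by rw [← h, sub_add_cancel_left, abs_neg, abs_of_pos hc0]) (hne u v)
        · exact absurd (by rw [h, add_sub_cancel_left, abs_of_pos hc0]) (hne u v)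
        · rw [hinj h] }
  have hD : M.UnitData c y := ⟨hc0, by linarith, fun v => rfl⟩
  have hI : ∀ u v, M.Inter u v ↔ |y u - y v| < c := by
    intro u v
    rw [hD.inter_iff]
    constructor
    · rintro ⟨n, hn⟩
      have hu := hy' u
      have hv := hy' v
      rw [abs_lt] at hn
      have h1 : (n : ℝ) < 1 := by linarith
      have h2 : (-1 : ℝ) < n := by linarith
      have h1' : n < 1 := by exact_mod_cast h1
      have h2' : -1 < n := by exact_mod_cast h2
      have : n = 0 := by omega
      subst this
      rw [abs_lt]; push_cast at hn; constructor <;> linarith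
    · intro h; exact ⟨0, by simpa using h⟩
  refine ⟨M, ?_, ?_, ?_, ?_⟩
  · have : ∀ v, (M.arc v).length = c := by
      intro v
      have h1 : (M.arc v).t - (M.arc v).s = ((c : ℝ) : Circ) := by
        show ((y v + c : ℝ) : Circ) - (y v : Circ) = _
        rw [← AddCircle.coe_sub, add_sub_cancel_left]
      unfold Arc.length
      rw [h1]
      exact AddCircle.equivIoc_coe_of_mem ⟨hc0, by linarith⟩
    intro u v; rw [this, this]
  · intro S hS
    by_cases hne : S.Nonempty
    · obtain ⟨A, hA, hmin⟩ := Set.exists_min_image S y (Set.toFinite S) hne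
      obtain ⟨C, hC, hmax⟩ := Set.exists_max_image S y (Set.toFinite S) hne
      have h1 := abs_lt.1 ((hI C A).1 (hS C hC A hA))
      refine ⟨(((y A + y C + c) / 2 : ℝ) : Circ), fun v hv => ?_⟩
      rw [hD.mem_pts]
      have h2 := hmin v hv
      have h3 := hmax v hv
      exact ⟨0, by push_cast; constructor <;> linarith⟩
    · exact ⟨0, fun v hv => absurd ⟨v, hv⟩ hne⟩
  · refine ⟨((1/2 : ℝ) : Circ), fun v hv => ?_⟩
    obtain ⟨n, hn1, hn2⟩ := (hD.mem_pts v _).1 hv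
    have hv := hy' v
    have h1 : (n : ℝ) < 0 := by linarith
    have h2 : (-1 : ℝ) < n := by linarith
    have h1' : n < 0 := by exact_mod_cast h1
    have h2' : -1 < n := by exact_mod_cast h2
    omega
  · intro u v; rw [hI, hiff]

/-- A graph is UHCA iff it is both PHCA and UCA; moreover, every unit
circular-arc model of a UHCA graph that is not an interval graph is itself a UHCA
model. -/
theorem stmt_11 {V : Type} [Fintype V] (G : SimpleGraph V) :
    (IsUHCAGraph G ↔ (IsPHCAGraph G ∧ IsUCAGraph G)) ∧
    (IsUHCAGraph G → ¬ IsIntervalGraph G →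
      ∀ (W : Type) [Fintype W] (M : CAModel W), M.IsUnit →
        Nonempty (M.interGraph ≃g G) → M.IsUnit ∧ M.Helly) := by
  have fwd : IsUHCAGraph G → IsPHCAGraph G := by
    rintro ⟨M, hU, hH, hM⟩
    exact ⟨M, M.proper_of_unit hU, hH, hM⟩
  have key : IsPHCAGraph G → ∀ (W : Type) [Fintype W] (M : CAModel W), M.IsUnit →
      Nonempty (M.interGraph ≃g G) → M.Helly ∨
      ∃ M' : CAModel V, M'.IsUnit ∧ M'.Helly ∧ M'.IsIntervalModel ∧ M'.IsModelOf G := by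
    rintro ⟨M1, hP, hH, hM1⟩ W _ M hU ⟨f⟩
    have he : ∀ u v, u ≠ v → (M1.Inter u v ↔ M.Inter (f.symm u) (f.symm v)) := by
      intro u v huv
      have h1 : M1.Inter u v ↔ G.Adj u v := by rw [hM1 u v]; tauto
      rw [h1, ← f.symm.map_adj_iff]
      unfold CAModel.interGraph
      rw [SimpleGraph.fromRel_adj]
      constructor
      · rintro ⟨-, h | h⟩
        · exact h
        · exact M.inter_symm h
      · intro h
        exact ⟨fun h' => huv (f.symm.injective h'), Or.inl h⟩
    rcases CAModel.core M1 hP hH M hU f.symm.toEquiv he with h | ⟨x, hx⟩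
    · exact Or.inl h
    · right
      obtain ⟨M', h1, h2, h3, h4⟩ := model_of_rep x
      refine ⟨M', h1, h2, h3, fun u v => ?_⟩
      rw [hM1 u v, h4, hx]
  refine ⟨⟨fun h => ⟨fwd h, ?_⟩, ?_⟩, ?_⟩
  · obtain ⟨M, hU, -, hM⟩ := h
    exact ⟨M, hU, hM⟩
  · rintro ⟨hP, M, hU, hM⟩
    have hG : M.interGraph = G := by
      ext u v
      rw [hM u v]
      unfold CAModel.interGraph
      rw [SimpleGraph.fromRel_adj]
      constructor
      · rintro ⟨h, h' | h'⟩
        · exact ⟨h, h'⟩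
        · exact ⟨h, M.inter_symm h'⟩
      · rintro ⟨h, h'⟩
        exact ⟨h, Or.inl h'⟩
    rcases key hP V M hU ⟨by rw [hG]⟩ with h | ⟨M', h1, h2, -, h4⟩
    · exact ⟨M, hU, h, hM⟩
    · exact ⟨M', h1, h2, h4⟩
  · intro h hni W _ M hU hf
    refine ⟨hU, ?_⟩
    rcases key (fwd h) W M hU hf with h | ⟨M', -, -, h3, h4⟩
    · exact h
    · exact absurd ⟨M', h3, h4⟩ hni
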